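/- Let 𝔏 be a finite-dimensional semisimple Leibniz algebra over an algebraically closed field K of characteristic zero and let n ≥ 2. Then a subspace of 𝔏 is an ideal of the Leibniz n-algebra U_n(𝔏) if and only if it is an ideal of the Leibniz algebra 𝔏. -/

import Mathlib

section Defs

variable {K L : Type*}

/-- Right-nested iterated bracket `[x₀,[x₁,[…,[xₙ₋₁,xₙ]…]]]` built from a binary bracket. -/
def nestedBracket (b : L → L → L) : {n : ℕ} → (Fin (n + 1) → L) → L
  | 0, x => x 0
  | _ + 1, x => b (x 0) (nestedBracket b fun i => x i.succ)

/-- The (right) Leibniz identity for a binary bracket. -/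
def IsLeibniz [Add L] (b : L → L → L) : Prop :=
  ∀ x y z, b (b x y) z = b (b x z) y + b x (b y z)

/-- The fundamental identity of a Leibniz `n`-algebra (arity `n + 1`). -/
def LeibnizNIdentity [AddCommMonoid L] {n : ℕ} (br : (Fin (n + 1) → L) → L) : Prop :=
  ∀ (x : Fin (n + 1) → L) (y : Fin n → L),
    br (Fin.cons (br x) y) =
      ∑ i : Fin (n + 1), br (Function.update x i (br (Fin.cons (x i) y)))

variable [Field K] [AddCommGroup L] [Module K L]

/-- A subspace `I` is an ideal of a Leibniz `n`-algebra: it is an `s`-ideal for every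
position `s`, i.e. `[z₁,…,zₙ] ∈ I` whenever some `z_s ∈ I`. -/
def IsNIdeal {n : ℕ} (br : (Fin (n + 1) → L) → L) (I : Submodule K L) : Prop :=
  ∀ (s : Fin (n + 1)) (z : Fin (n + 1) → L), z s ∈ I → br z ∈ I

/-- The Leibniz `n`-kernel: the smallest ideal containing all brackets with a repeated entry. -/
def leibnizNKernel {n : ℕ} (br : (Fin (n + 1) → L) → L) : Submodule K L :=
  sInf {I : Submodule K L |
    IsNIdeal br I ∧ ∀ z : Fin (n + 1) → L, (∃ i j, i < j ∧ z i = z j) → br z ∈ I}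

/-- A subspace `I` is a (two-sided) ideal of a Leibniz algebra. -/
def IsLeibnizIdeal (b : L →ₗ[K] L →ₗ[K] L) (I : Submodule K L) : Prop :=
  (∀ x ∈ I, ∀ y : L, b x y ∈ I) ∧ (∀ x ∈ I, ∀ y : L, b y x ∈ I)

/-- The Leibniz kernel `span {[x,x] : x ∈ L}` of a Leibniz algebra. -/
def leibnizKernel (b : L →ₗ[K] L →ₗ[K] L) : Submodule K L :=
  Submodule.span K {v : L | ∃ x : L, b x x = v}

/-- The derived series of a subspace of a Leibniz algebra. -/
def derivedSeriesSub (b : L →ₗ[K] L →ₗ[K] L) (S : Submodule K L) : ℕ → Submodule K L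
  | 0 => S
  | m + 1 => Submodule.span K
      {v : L | ∃ a ∈ derivedSeriesSub b S m, ∃ c ∈ derivedSeriesSub b S m, b a c = v}

/-- The `k`-derived series `H^{(m+1)_k}` of a subspace of a Leibniz `n`-algebra
(indexed so that index `0` corresponds to `H^{(1)_k} = H`). -/
def kSeries {n : ℕ} (br : (Fin (n + 1) → L) → L) (k : ℕ) (H : Submodule K L) :
    ℕ → Submodule K L
  | 0 => H
  | p + 1 => Submodule.span K
      {v : L | ∃ z : Fin (n + 1) → L, ∃ s : Finset (Fin (n + 1)),
        k ≤ s.card ∧ (∀ i ∈ s, z i ∈ kSeries br k H p) ∧ br z = v}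

end Defs

namespace LieAlgebra

variable {K g : Type*} [Field K] [CharZero K] [LieRing g] [LieAlgebra K g]
  [FiniteDimensional K g] [HasTrivialRadical K g]

theorem top_lie_eq_self_of_hasTrivialRadical (J : LieIdeal K g) :
    ⁅(⊤ : LieIdeal K g), J⁆ = J := by
  refine le_antisymm (LieSubmodule.lie_le_right _ _) ?_
  obtain ⟨C, hC⟩ := exists_isCompl ⁅(⊤ : LieIdeal K g), J⁆
  have hN : C ⊓ J = ⊥ := by
    refine (hasTrivialRadical_iff_no_abelian_ideals K g).mp inferInstance _ ?_
    rw [LieSubmodule.lie_abelian_iff_lie_self_eq_bot, eq_bot_iff, ← hC.inf_eq_bot]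
    exact le_inf (LieSubmodule.mono_lie le_top inf_le_right)
      ((LieSubmodule.lie_le_right _ _).trans inf_le_left)
  calc J = (⁅(⊤ : LieIdeal K g), J⁆ ⊔ C) ⊓ J := by rw [hC.sup_eq_top, top_inf_eq]
    _ = ⁅(⊤ : LieIdeal K g), J⁆ ⊔ C ⊓ J :=
      sup_inf_assoc_of_le _ (LieSubmodule.lie_le_right _ _)
    _ ≤ ⁅(⊤ : LieIdeal K g), J⁆ := by rw [hN, sup_bot_eq]

end LieAlgebra

section Leibniz

variable {K L : Type*} [Field K] [AddCommGroup L] [Module K L] {b : L →ₗ[K] L →ₗ[K] L}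

theorem bracket_eq_zero_of_mem_leibnizKernel (hb : IsLeibniz fun x y => b x y) (x : L) {l : L}
    (hl : l ∈ leibnizKernel b) : b x l = 0 := by
  have : leibnizKernel b ≤ LinearMap.ker (b x) := by
    refine Submodule.span_le.mpr ?_
    rintro _ ⟨y, rfl⟩
    simpa using hb x y y
  exact this hl

variable (b) in
theorem bracket_add_bracket_swap_mem_leibnizKernel (x y : L) :
    b x y + b y x ∈ leibnizKernel b := by
  have h (z : L) : b z z ∈ leibnizKernel b := Submodule.subset_span ⟨z, rfl⟩
  have := sub_mem (sub_mem (h (x + y)) (h x)) (h y)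
  convert this using 1
  simp only [map_add, LinearMap.add_apply]
  abel

theorem bracket_mem_leibnizKernel (hb : IsLeibniz fun x y => b x y) (x : L) {l : L}
    (hl : l ∈ leibnizKernel b) : b l x ∈ leibnizKernel b := by
  simpa [bracket_eq_zero_of_mem_leibnizKernel hb x hl] using
    bracket_add_bracket_swap_mem_leibnizKernel b l x

/-- The bracket induced on the quotient of a Leibniz algebra by its Leibniz kernel. -/
def leibnizQuotientBracket (hb : IsLeibniz fun x y => b x y) :
    (L ⧸ leibnizKernel b) →ₗ[K] (L ⧸ leibnizKernel b) →ₗ[K] (L ⧸ leibnizKernel b) :=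
  (leibnizKernel b).liftQ
    (LinearMap.flip ((leibnizKernel b).liftQ (b.compr₂ (leibnizKernel b).mkQ).flip
      fun l hl => by
        ext x
        simp [bracket_eq_zero_of_mem_leibnizKernel hb x hl]))
    fun l hl => by
      ext x
      exact (Submodule.Quotient.mk_eq_zero _).mpr (bracket_mem_leibnizKernel hb x hl)

/-- The Lie ring obtained from a Leibniz algebra by factoring out its Leibniz kernel. -/
abbrev leibnizQuotientLieRing (hb : IsLeibniz fun x y => b x y) :
    LieRing (L ⧸ leibnizKernel b) where
  bracket x y := leibnizQuotientBracket hb x y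
  add_lie x y z := by simp
  lie_add x y z := by simp
  lie_self x := by
    obtain ⟨x, rfl⟩ := (leibnizKernel b).mkQ_surjective x
    change (leibnizKernel b).mkQ (b x x) = 0
    exact (Submodule.Quotient.mk_eq_zero _).mpr (Submodule.subset_span ⟨x, rfl⟩)
  leibniz_lie x y z := by
    obtain ⟨x, rfl⟩ := (leibnizKernel b).mkQ_surjective x
    obtain ⟨y, rfl⟩ := (leibnizKernel b).mkQ_surjective y
    obtain ⟨z, rfl⟩ := (leibnizKernel b).mkQ_surjective z
    change (leibnizKernel b).mkQ (b x (b y z)) =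
      (leibnizKernel b).mkQ (b (b x y) z) + (leibnizKernel b).mkQ (b y (b x z))
    rw [← map_add, ← sub_eq_zero, ← map_sub, Submodule.mkQ_apply, Submodule.Quotient.mk_eq_zero]
    have h : b (b x y) z = b (b x z) y + b x (b y z) := hb x y z
    have := neg_mem (bracket_add_bracket_swap_mem_leibnizKernel b (b x z) y)
    rw [h]
    convert this using 1
    abel

/-- The Lie algebra obtained from a Leibniz algebra by factoring out its Leibniz kernel. -/
abbrev leibnizQuotientLieAlgebra (hb : IsLeibniz fun x y => b x y) :
    letI := leibnizQuotientLieRing hb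
    LieAlgebra K (L ⧸ leibnizKernel b) :=
  letI := leibnizQuotientLieRing hb
  { lie_smul := fun t x y => (leibnizQuotientBracket hb x).map_smul t y }

theorem hasTrivialRadical_leibnizQuotient (hb : IsLeibniz fun x y => b x y)
    (hss : ∀ I : Submodule K L, IsLeibnizIdeal b I →
      (∃ m, derivedSeriesSub b I m = ⊥) → I ≤ leibnizKernel b)
    [FiniteDimensional K L] :
    letI := leibnizQuotientLieRing hb
    letI := leibnizQuotientLieAlgebra hb
    LieAlgebra.HasTrivialRadical K (L ⧸ leibnizKernel b) := by
  let := leibnizQuotientLieRing hb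
  let := leibnizQuotientLieAlgebra hb
  rw [LieAlgebra.hasTrivialRadical_iff_no_abelian_ideals]
  intro J hJ
  have hle := hss (J.toSubmodule.comap (leibnizKernel b).mkQ)
    ⟨fun x hx y => lie_mem_left K _ J _ ((leibnizKernel b).mkQ y) hx,
      fun x hx y => lie_mem_right K _ J ((leibnizKernel b).mkQ y) _ hx⟩ ⟨2, by
    have h1 : derivedSeriesSub b (J.toSubmodule.comap (leibnizKernel b).mkQ) 1 ≤
        leibnizKernel b := by
      refine Submodule.span_le.mpr ?_
      rintro _ ⟨x, hx, y, hy, rfl⟩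
      have h := congrArg Subtype.val (hJ.trivial ⟨_, hx⟩ ⟨_, hy⟩)
      exact (Submodule.Quotient.mk_eq_zero _).mp h
    refine eq_bot_iff.mpr (Submodule.span_le.mpr ?_)
    rintro _ ⟨x, -, y, hy, rfl⟩
    exact bracket_eq_zero_of_mem_leibnizKernel hb x (h1 hy)⟩
  refine (LieSubmodule.eq_bot_iff J).mpr fun x hx => ?_
  obtain ⟨x, rfl⟩ := (leibnizKernel b).mkQ_surjective x
  exact (Submodule.Quotient.mk_eq_zero _).mpr (hle hx)

variable (b) in
/-- The span of the brackets `[x, y]` with `x ∈ I`. -/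
def rightBracketSpan (I : Submodule K L) : Submodule K L :=
  Submodule.span K {v : L | ∃ x ∈ I, ∃ y : L, b x y = v}

theorem le_rightBracketSpan_sup_leibnizKernel [CharZero K] [FiniteDimensional K L]
    (hb : IsLeibniz fun x y => b x y)
    (hss : ∀ I : Submodule K L, IsLeibnizIdeal b I →
      (∃ m, derivedSeriesSub b I m = ⊥) → I ≤ leibnizKernel b)
    {I : Submodule K L} (hI : ∀ x ∈ I, ∀ y : L, b x y ∈ I) :
    I ≤ rightBracketSpan b I ⊔ leibnizKernel b := by
  let := leibnizQuotientLieRing hb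
  let := leibnizQuotientLieAlgebra hb
  have := hasTrivialRadical_leibnizQuotient hb hss
  let J : LieIdeal K (L ⧸ leibnizKernel b) :=
    { I.map (leibnizKernel b).mkQ with
      lie_mem := by
        rintro y _ ⟨x, hx, rfl⟩
        obtain ⟨y, rfl⟩ := (leibnizKernel b).mkQ_surjective y
        rw [← lie_skew]
        exact neg_mem (Submodule.mem_map_of_mem (hI x hx y)) }
  have hJ : J.toSubmodule ≤ (rightBracketSpan b I).map (leibnizKernel b).mkQ := by
    rw [← LieAlgebra.top_lie_eq_self_of_hasTrivialRadical J,
      LieSubmodule.lieIdeal_oper_eq_linear_span', Submodule.span_le]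
    rintro _ ⟨y, -, _, ⟨x, hx, rfl⟩, rfl⟩
    obtain ⟨y, rfl⟩ := (leibnizKernel b).mkQ_surjective y
    rw [← lie_skew]
    exact neg_mem (Submodule.mem_map_of_mem (Submodule.subset_span ⟨x, hx, y, rfl⟩))
  have h := Submodule.map_le_iff_le_comap.mp hJ
  rwa [Submodule.comap_map_mkQ, sup_comm] at h

theorem span_range_nestedBracket_eq_top (h : rightBracketSpan b ⊤ = ⊤) (n : ℕ) :
    Submodule.span K (Set.range (nestedBracket (n := n) fun x y => b x y)) = ⊤ := by
  induction n with
  | zero =>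
    refine eq_top_iff.mpr fun x _ => Submodule.subset_span ⟨fun _ => x, rfl⟩
  | succ n ih =>
    rw [eq_top_iff, ← h]
    refine Submodule.span_le.mpr ?_
    rintro _ ⟨x, -, y, rfl⟩
    have hy : y ∈ Submodule.span K (Set.range (nestedBracket (n := n) fun x y => b x y)) :=
      ih ▸ Submodule.mem_top
    refine Submodule.span_le (p := (Submodule.span K _).comap (b x)).mpr ?_ hy
    rintro _ ⟨z, rfl⟩
    exact Submodule.subset_span ⟨Fin.cons x z, rfl⟩

theorem IsLeibnizIdeal.isNIdeal {I : Submodule K L} (hI : IsLeibnizIdeal b I) (n : ℕ) :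
    IsNIdeal (nestedBracket (n := n) fun x y => b x y) I := by
  induction n with
  | zero =>
    intro s z hz
    rwa [Subsingleton.elim (α := Fin 1) s 0] at hz
  | succ n ih =>
    intro s z hz
    cases s using Fin.cases with
    | zero => exact hI.1 _ hz _
    | succ s => exact hI.2 _ (ih s (fun i => z i.succ) hz) _

end Leibniz

/-- For a finite-dimensional semisimple Leibniz algebra `𝔏` over an
algebraically closed field of characteristic zero and `n ≥ 2` (arity `n + 1`, `1 ≤ n`),
a subspace of `𝔏` is an ideal of the Leibniz `n`-algebra `U_n(𝔏)` if and only if it is an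
ideal of the Leibniz algebra `𝔏`. -/
theorem stmt_15 {K L : Type*} [Field K] [IsAlgClosed K] [CharZero K]
    [AddCommGroup L] [Module K L] [FiniteDimensional K L]
    (b : L →ₗ[K] L →ₗ[K] L) (hb : IsLeibniz fun x y => b x y)
    (hss : ∀ I : Submodule K L, IsLeibnizIdeal b I →
      (∃ m, derivedSeriesSub b I m = ⊥) → I ≤ leibnizKernel b)
    (n : ℕ) (hn : 1 ≤ n) :
    ∀ I : Submodule K L,
      IsNIdeal (nestedBracket (n := n) fun a c => b a c) I ↔ IsLeibnizIdeal b I := by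
  refine fun I => ⟨fun hI => ?_, fun hI => hI.isNIdeal n⟩
  obtain ⟨n, rfl⟩ := Nat.exists_eq_add_of_le' hn
  have hperfect : rightBracketSpan b ⊤ = ⊤ := by
    have h := le_rightBracketSpan_sup_leibnizKernel hb hss (I := ⊤) fun _ _ _ => trivial
    have hle : leibnizKernel b ≤ rightBracketSpan b ⊤ := by
      refine Submodule.span_mono ?_
      rintro _ ⟨x, rfl⟩
      exact ⟨x, trivial, x, rfl⟩
    rwa [sup_eq_left.mpr hle, top_le_iff] at h
  have hspan := span_range_nestedBracket_eq_top hperfect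
  have hright : ∀ x ∈ I, ∀ y : L, b x y ∈ I := by
    intro x hx y
    refine Submodule.span_le (p := I.comap (b x)).mpr ?_ (hspan n ▸ Submodule.mem_top : y ∈ _)
    rintro _ ⟨z, rfl⟩
    exact hI 0 (Fin.cons x z) hx
  refine ⟨hright, fun x hx y => ?_⟩
  cases n with
  | zero => exact hI 1 ![y, x] hx
  | succ n =>
    refine (?_ : rightBracketSpan b I ⊔ leibnizKernel b ≤ I.comap (b y))
      (le_rightBracketSpan_sup_leibnizKernel hb hss hright hx)
    refine sup_le (Submodule.span_le.mpr ?_) fun l hl => ?_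
    · rintro _ ⟨i, hi, w, rfl⟩
      refine Submodule.span_le (p := I.comap (b y ∘ₗ b i)).mpr ?_
        (hspan n ▸ Submodule.mem_top : w ∈ _)
      rintro _ ⟨z, rfl⟩
      exact hI 1 (Fin.cons y (Fin.cons i z)) hi
    · simp [bracket_eq_zero_of_mem_leibnizKernel hb y hl]
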